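/- The standard open Whitney umbrella Σ is totally real away from the origin: for every (t,s) ≠ (0,0), the tangent plane T = span{∂π/∂t(t,s), ∂π/∂s(t,s)} ⊆ ℝ⁴ satisfies T ∩ J(T) = {0}; equivalently, the four vectors ∂π/∂t, ∂π/∂s, J∂π/∂t, J∂π/∂s are linearly independent over ℝ. -/

import Mathlib

noncomputable section

/-- The standard open Whitney umbrella parametrization
`π(t,s) = (ts, 2t³/3, t², s)` into `ℝ⁴` with coordinates `(x,u,y,v)`. -/
def whitneyPi (p : ℝ × ℝ) : Fin 4 → ℝ :=
  ![p.1 * p.2, 2 * p.1 ^ 3 / 3, p.1 ^ 2, p.2]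

/-- The standard complex structure `J` on `ℝ⁴ ≅ ℂ²`: `J(x,u,y,v) = (−y,−v,x,u)`. -/
def Jstd (w : Fin 4 → ℝ) : Fin 4 → ℝ :=
  ![-(w 2), -(w 3), w 0, w 1]

/-- The differential of `whitneyPi` at `(t,s)` sends `(a,b)` to `(as + bt, 2t²a, 2ta, b)`. -/
lemma fderiv_whitneyPi_apply (p v : ℝ × ℝ) :
    fderiv ℝ whitneyPi p v =
      ![v.1 * p.2 + v.2 * p.1, 2 * p.1 ^ 2 * v.1, 2 * p.1 * v.1, v.2] := by
  have h₁ : HasFDerivAt (fun q : ℝ × ℝ => q.1) (ContinuousLinearMap.fst ℝ ℝ ℝ) p :=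
    hasFDerivAt_fst
  have h₂ : HasFDerivAt (fun q : ℝ × ℝ => q.2) (ContinuousLinearMap.snd ℝ ℝ ℝ) p :=
    hasFDerivAt_snd
  have hd : DifferentiableAt ℝ whitneyPi p := by
    rw [differentiableAt_pi]
    intro i
    fin_cases i <;> simp only [whitneyPi] <;> dsimp <;> fun_prop
  ext i
  have hi : fderiv ℝ whitneyPi p v i = fderiv ℝ (fun q => whitneyPi q i) p v := by
    rw [fderiv_apply hd]
    rfl
  rw [hi]
  fin_cases i
  · have h : HasFDerivAt (fun q => whitneyPi q 0) _ p := h₁.mul h₂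
    simp [h.fderiv]
    ring
  · have h : HasFDerivAt (fun q => whitneyPi q 1) _ p :=
      ((h₁.pow 3).const_mul 2).mul_const (3⁻¹)
    simp [h.fderiv]
    ring
  · have h : HasFDerivAt (fun q => whitneyPi q 2) _ p := h₁.pow 2
    simp [h.fderiv]
  · have h : HasFDerivAt (fun q => whitneyPi q 3) _ p := h₂
    simp [h.fderiv]

/-- The standard open Whitney umbrella is totally real away from the origin: for
`(t,s) ≠ (0,0)` the vectors `∂π/∂t`, `∂π/∂s`, `J∂π/∂t`, `J∂π/∂s` are linearly
independent over `ℝ`, i.e. the tangent plane `T` satisfies `T ∩ J(T) = {0}`. -/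
theorem whitneyPi_totally_real :
    ∀ p : ℝ × ℝ, p ≠ 0 →
      LinearIndependent ℝ
        ![fderiv ℝ whitneyPi p (1, 0), fderiv ℝ whitneyPi p (0, 1),
          Jstd (fderiv ℝ whitneyPi p (1, 0)), Jstd (fderiv ℝ whitneyPi p (0, 1))] := by
  rintro ⟨t, s⟩ hp
  have hdet : 0 < s ^ 2 + (2 * t + 2 * t ^ 3) ^ 2 := by
    by_contra! hle
    have hs : s = 0 := by nlinarith [sq_nonneg s, sq_nonneg (2 * t + 2 * t ^ 3)]
    have ht : t * (1 + t ^ 2) = 0 := by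
      nlinarith [sq_nonneg s, sq_nonneg (t * (1 + t ^ 2))]
    have ht' : t = 0 := (mul_eq_zero.mp ht).resolve_right (by positivity)
    exact hp (by simp [hs, ht'])
  rw [Fintype.linearIndependent_iff]
  intro g hg
  simp only [fderiv_whitneyPi_apply, Jstd] at hg
  have e₀ := congrFun hg 0
  have e₁ := congrFun hg 1
  have e₂ := congrFun hg 2
  have e₃ := congrFun hg 3
  simp [Fin.sum_univ_four] at e₀ e₁ e₂ e₃
  have h₀ : g 0 = 0 := by
    refine (mul_eq_zero.mp ?_).resolve_left hdet.ne'
    linear_combination s * e₀ + (2 * t + 2 * t ^ 3) * (e₂ + t * e₁) - s * t * e₃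
  have h₂ : g 2 = 0 := by
    refine (mul_eq_zero.mp ?_).resolve_left hdet.ne'
    linear_combination s * (e₂ + t * e₁) - (2 * t + 2 * t ^ 3) * (e₀ - t * e₃)
  have h₁ : g 1 = 0 := by linear_combination e₃ - 2 * t ^ 2 * h₂
  have h₃ : g 3 = 0 := by linear_combination -e₁ + 2 * t ^ 2 * h₀
  intro i
  fin_cases i <;> assumption
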